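/- (Lemma 4.1) Let p > 2 be a prime, b ∈ ℚ_p with 0 < |b|_p < 1, f(x) = x²/(bx + 1), x₂ = 1/(1−b), and 0 < ρ < 1. For every ball B_r(c) contained in the sphere S_ρ(x₂) with r < ρ, the image of B_r(c) under f equals B_r(f(c)): f(B_r(c)) = B_r(f(c)). -/

import Mathlib

theorem Padic.norm_eq_one_of_norm_sub_lt_one {p : ℕ} [Fact p.Prime] {x y : ℚ_[p]}
    (hy : ‖y‖ = 1) (h : ‖x - y‖ < 1) : ‖x‖ = 1 :=
  (Padic.norm_eq_of_norm_sub_lt_right (by rwa [hy])).trans hy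

theorem Padic.norm_add_lt {p : ℕ} [Fact p.Prime] {x y : ℚ_[p]} {r : ℝ}
    (hx : ‖x‖ < r) (hy : ‖y‖ < r) : ‖x + y‖ < r :=
  (Padic.nonarchimedean x y).trans_lt (max_lt hx hy)

theorem Padic.norm_two {p : ℕ} [Fact p.Prime] (hp : 2 < p) : ‖(2 : ℚ_[p])‖ = 1 := by
  have h := Padic.norm_natCast_eq_one_iff (p := p) (n := 2)
  rw [Nat.cast_ofNat] at h
  exact h.2 ((Nat.coprime_primes Fact.out Nat.prime_two).2 hp.ne')

/-- Hensel's lemma for a monic quadratic polynomial with a simple root in the residue field. -/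
theorem Padic.exists_sq_eq_mul_add {p : ℕ} [Fact p.Prime] {s t a : ℚ_[p]}
    (hs : ‖s‖ ≤ 1) (ht : ‖t‖ ≤ 1) (ha : ‖a‖ ≤ 1)
    (hval : ‖a ^ 2 - s * a - t‖ < 1) (hder : ‖2 * a - s‖ = 1) :
    ∃ z : ℚ_[p], z ^ 2 = s * z + t ∧ ‖z - a‖ < 1 := by
  obtain ⟨s, rfl⟩ : ∃ u : ℤ_[p], (u : ℚ_[p]) = s := ⟨⟨s, hs⟩, rfl⟩
  obtain ⟨t, rfl⟩ : ∃ u : ℤ_[p], (u : ℚ_[p]) = t := ⟨⟨t, ht⟩, rfl⟩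
  obtain ⟨a, rfl⟩ : ∃ u : ℤ_[p], (u : ℚ_[p]) = a := ⟨⟨a, ha⟩, rfl⟩
  let F : Polynomial ℤ_[p] :=
    Polynomial.X ^ 2 - Polynomial.C s * Polynomial.X - Polynomial.C t
  have hF : ∀ z, F.aeval z = z ^ 2 - s * z - t := fun z => by simp [F]
  have hF' : F.derivative.aeval a = 2 * a - s := by simp [F, one_add_one_eq_two]
  have hder' : ‖2 * a - s‖ = 1 := by
    rw [PadicInt.norm_def]; exact_mod_cast hder
  have hval' : ‖a ^ 2 - s * a - t‖ < 1 := by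
    rw [PadicInt.norm_def]; exact_mod_cast hval
  obtain ⟨z, hz, hza, -⟩ := hensels_lemma (F := F) (a := a) (by
    rw [hF, hF', hder', one_pow]; exact hval')
  rw [hF] at hz
  rw [hF', hder', PadicInt.norm_def] at hza
  refine ⟨z, ?_, by exact_mod_cast hza⟩
  have : z ^ 2 = s * z + t := by linear_combination hz
  simpa using congrArg ((↑) : ℤ_[p] → ℚ_[p]) this

theorem Padic.norm_mul_add_one {p : ℕ} [Fact p.Prime] {b x : ℚ_[p]}
    (hb : ‖b‖ < 1) (hx : ‖x‖ = 1) : ‖b * x + 1‖ = 1 :=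
  Padic.norm_eq_one_of_norm_sub_lt_one norm_one (by
    rwa [add_sub_cancel_right, norm_mul, hx, mul_one])

/-- The map `x ↦ x ^ 2 / (b * x + 1)` preserves distances on the residue disc of a unit. -/
theorem Padic.norm_sq_div_sub_sq_div {p : ℕ} [Fact p.Prime] (hp : 2 < p) {b x c : ℚ_[p]}
    (hb : ‖b‖ < 1) (hc : ‖c‖ = 1) (hxc : ‖x - c‖ < 1) :
    ‖x ^ 2 / (b * x + 1) - c ^ 2 / (b * c + 1)‖ = ‖x - c‖ := by
  have hx := Padic.norm_eq_one_of_norm_sub_lt_one hc hxc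
  have hdx := Padic.norm_mul_add_one hb hx
  have hdc := Padic.norm_mul_add_one hb hc
  have hdx0 : b * x + 1 ≠ 0 := norm_ne_zero_iff.1 (by simp [hdx])
  have hdc0 : b * c + 1 ≠ 0 := norm_ne_zero_iff.1 (by simp [hdc])
  have hnum : ‖x + c + b * x * c‖ = 1 := by
    refine Padic.norm_eq_one_of_norm_sub_lt_one (y := 2 * c) ?_ ?_
    · rw [norm_mul, Padic.norm_two hp, hc, one_mul]
    · rw [show x + c + b * x * c - 2 * c = (x - c) + b * x * c by ring]
      exact Padic.norm_add_lt hxc (by rwa [norm_mul, norm_mul, hx, hc, mul_one, mul_one])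
  rw [show x ^ 2 / (b * x + 1) - c ^ 2 / (b * c + 1)
      = (x - c) * (x + c + b * x * c) / ((b * x + 1) * (b * c + 1)) by
    rw [div_sub_div _ _ hdx0 hdc0]; ring]
  rw [norm_div, norm_mul, norm_mul, hnum, hdx, hdc]
  simp

/-- Lemma 4.1: for p > 2, 0 < |b|_p < 1, f(x) = x²/(bx+1), x₂ = 1/(1−b), and
0 < ρ < 1: for every ball B_r(c) ⊆ S_ρ(x₂) with r < ρ, the image of B_r(c)
under f is exactly B_r(f(c)). -/
theorem image_of_ball {p : ℕ} [Fact p.Prime] (hp : 2 < p)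
    (b : ℚ_[p]) (hb : b ≠ 0) (hbnorm : ‖b‖ < 1)
    (f : ℚ_[p] → ℚ_[p]) (hf : ∀ x, f x = x ^ 2 / (b * x + 1))
    (x₂ : ℚ_[p]) (hx₂ : x₂ = 1 / (1 - b))
    (ρ : ℝ) (hρ0 : 0 < ρ) (hρ1 : ρ < 1)
    (c : ℚ_[p]) (r : ℝ) (hr0 : 0 < r) (hrρ : r < ρ)
    (hsub : Metric.ball c r ⊆ Metric.sphere x₂ ρ) :
    f '' Metric.ball c r = Metric.ball (f c) r := by
  have hr1 := hrρ.trans hρ1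
  have h1b : ‖1 - b‖ = 1 :=
    Padic.norm_eq_one_of_norm_sub_lt_one norm_one (by simpa using hbnorm)
  have hx₂n : ‖x₂‖ = 1 := by rw [hx₂, norm_div, h1b, norm_one, div_one]
  have hc : ‖c‖ = 1 := by
    have h := hsub (Metric.mem_ball_self hr0)
    rw [mem_sphere_iff_norm] at h
    exact Padic.norm_eq_one_of_norm_sub_lt_one hx₂n (h.trans_lt hρ1)
  have hdist : ∀ x, ‖x - c‖ < 1 → ‖f x - f c‖ = ‖x - c‖ := fun x hx => by
    rw [hf, hf]; exact Padic.norm_sq_div_sub_sq_div hp hbnorm hc hx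
  have hdc := Padic.norm_mul_add_one hbnorm hc
  have hdc0 : b * c + 1 ≠ 0 := norm_ne_zero_iff.1 (by simp [hdc])
  have hfc : ‖f c‖ = 1 := by rw [hf, norm_div, norm_pow, hc, hdc]; simp
  ext y
  simp only [Set.mem_image, mem_ball_iff_norm]
  constructor
  · rintro ⟨x, hx, rfl⟩
    rwa [hdist x (hx.trans hr1)]
  · intro hy
    have hyn := Padic.norm_eq_one_of_norm_sub_lt_one hfc (hy.trans hr1)
    have hyb : ‖y * b‖ < 1 := by rwa [norm_mul, hyn, one_mul]
    obtain ⟨z, hz, hzc⟩ := Padic.exists_sq_eq_mul_add (s := y * b) (t := y) (a := c)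
      hyb.le hyn.le hc.le
      (by
        have : c ^ 2 - y * b * c - y = (f c - y) * (b * c + 1) := by
          rw [sub_mul, hf, div_mul_cancel₀ _ hdc0]; ring
        rw [this, norm_mul, hdc, mul_one, norm_sub_rev]
        exact hy.trans hr1)
      (Padic.norm_eq_one_of_norm_sub_lt_one (y := 2 * c)
        (by rw [norm_mul, Padic.norm_two hp, hc, one_mul])
        (by rwa [sub_sub_cancel_left, norm_neg]))
    have hdz := Padic.norm_mul_add_one hbnorm
      (Padic.norm_eq_one_of_norm_sub_lt_one hc hzc)
    have hdz0 : b * z + 1 ≠ 0 := norm_ne_zero_iff.1 (by simp [hdz])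
    have hfz : f z = y := by
      rw [hf, div_eq_iff hdz0]; linear_combination hz
    exact ⟨z, by rwa [← hdist z hzc, hfz], hfz⟩
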